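/- arXiv:2402.01921 — 2 statements merged into one kernel-verified Lean document; each statement's English description precedes it below -/
import Mathlib

section
/- For a prime p ≥ 7, the third integral homology group H₃(PSL₂(F_p); ℤ) contains no element of order p. -/
/-- `PSL₂(F_p) = SL₂(F_p)/{±I}`, the projective special linear group. -/
abbrev PSL2 (p : ℕ) :=
  Matrix.SpecialLinearGroup (Fin 2) (ZMod p) ⧸
    Subgroup.center (Matrix.SpecialLinearGroup (Fin 2) (ZMod p))

open Finsupp in
/-- The third differential of the inhomogeneous bar complex computing the integral group
homology of `G`: `d₃(g₁,g₂,g₃) = (g₂,g₃) − (g₁g₂,g₃) + (g₁,g₂g₃) − (g₁,g₂)`. -/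
noncomputable def barD3 (G : Type*) [Group G] :
    ((G × G × G) →₀ ℤ) →ₗ[ℤ] ((G × G) →₀ ℤ) :=
  Finsupp.lift _ ℤ _ fun t =>
    single (t.2.1, t.2.2) 1 - single (t.1 * t.2.1, t.2.2) 1 +
      single (t.1, t.2.1 * t.2.2) 1 - single (t.1, t.2.1) 1

open Finsupp in
/-- The fourth differential of the inhomogeneous bar complex:
`d₄(g₁,g₂,g₃,g₄) = (g₂,g₃,g₄) − (g₁g₂,g₃,g₄) + (g₁,g₂g₃,g₄) − (g₁,g₂,g₃g₄) + (g₁,g₂,g₃)`. -/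
noncomputable def barD4 (G : Type*) [Group G] :
    ((G × G × G × G) →₀ ℤ) →ₗ[ℤ] ((G × G × G) →₀ ℤ) :=
  Finsupp.lift _ ℤ _ fun t =>
    single (t.2.1, t.2.2.1, t.2.2.2) 1 - single (t.1 * t.2.1, t.2.2.1, t.2.2.2) 1 +
      single (t.1, t.2.1 * t.2.2.1, t.2.2.2) 1 - single (t.1, t.2.1, t.2.2.1 * t.2.2.2) 1 +
      single (t.1, t.2.1, t.2.2.1) 1

/-- The third integral group homology `H₃(G; ℤ)`: 3-cycles modulo 3-boundaries in the
inhomogeneous bar complex. -/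
noncomputable def H3 (G : Type*) [Group G] :=
  LinearMap.ker (barD3 G) ⧸
    Submodule.comap (LinearMap.ker (barD3 G)).subtype (LinearMap.range (barD4 G))

noncomputable instance (G : Type*) [Group G] : AddCommGroup (H3 G) :=
  inferInstanceAs (AddCommGroup (_ ⧸ _))


set_option linter.unusedSectionVars false

namespace PSLH3

open Finsupp

/-- a cocycle of an action of `G` on `X` with values in `H` -/
def IsCoc {G H X : Type*} [Group G] [Group H] [MulAction G X] (α : G → X → H) : Prop :=
  ∀ g h x, α (g * h) x = α g (h • x) * α h x

section push

variable {G H X : Type*} [Group G] [Group H] [MulAction G X] [Fintype X]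

/-- push-forward of 2-chains -/
noncomputable def push2 (α : G → X → H) : ((G × G) →₀ ℤ) →ₗ[ℤ] ((H × H) →₀ ℤ) :=
  Finsupp.lift _ ℤ _ fun t => ∑ x : X, single (α t.1 (t.2 • x), α t.2 x) 1

/-- push-forward of 3-chains -/
noncomputable def push3 (α : G → X → H) : ((G × G × G) →₀ ℤ) →ₗ[ℤ] ((H × H × H) →₀ ℤ) :=
  Finsupp.lift _ ℤ _ fun t =>
    ∑ x : X, single (α t.1 (t.2.1 • t.2.2 • x), α t.2.1 (t.2.2 • x), α t.2.2 x) 1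

/-- push-forward of 4-chains -/
noncomputable def push4 (α : G → X → H) :
    ((G × G × G × G) →₀ ℤ) →ₗ[ℤ] ((H × H × H × H) →₀ ℤ) :=
  Finsupp.lift _ ℤ _ fun t =>
    ∑ x : X, single (α t.1 (t.2.1 • t.2.2.1 • t.2.2.2 • x), α t.2.1 (t.2.2.1 • t.2.2.2 • x),
      α t.2.2.1 (t.2.2.2 • x), α t.2.2.2 x) 1

lemma push2_single (α : G → X → H) (a b : G) : push2 α (single (a, b) 1) =
    ∑ x : X, single (α a (b • x), α b x) 1 := by
  simp [push2]

lemma push3_single (α : G → X → H) (a b c : G) : push3 α (single (a, b, c) 1) =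
    ∑ x : X, single (α a (b • c • x), α b (c • x), α c x) 1 := by
  simp [push3]

lemma push4_single (α : G → X → H) (a b c d : G) : push4 α (single (a, b, c, d) 1) =
    ∑ x : X, single (α a (b • c • d • x), α b (c • d • x), α c (d • x), α d x) 1 := by
  simp [push4]

lemma barD3_single (a b c : G) : barD3 G (single (a, b, c) 1) =
    single (b, c) 1 - single (a * b, c) 1 + single (a, b * c) 1 - single (a, b) 1 := by
  simp [barD3]

lemma barD4_single (a b c d : G) : barD4 G (single (a, b, c, d) 1) =
    single (b, c, d) 1 - single (a * b, c, d) 1 + single (a, b * c, d) 1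
      - single (a, b, c * d) 1 + single (a, b, c) 1 := by
  simp [barD4]

lemma barD3_push {α : G → X → H} (hα : IsCoc α) (z) :
    barD3 H (push3 α z) = push2 α (barD3 G z) := by
  suffices h : barD3 H ∘ₗ push3 α = push2 α ∘ₗ barD3 G from LinearMap.congr_fun h z
  refine Finsupp.lhom_ext' fun ⟨a, b, c⟩ => LinearMap.ext_ring ?_
  simp only [LinearMap.comp_apply, lsingle_apply, barD3_single, push3_single, map_sum, map_add,
    map_sub, push2_single, Finset.sum_add_distrib, Finset.sum_sub_distrib, mul_smul, hα a b,
    hα b c]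
  congr 1
  exact Fintype.sum_equiv (MulAction.toPerm c) _ _ fun x => rfl

lemma barD4_push {α : G → X → H} (hα : IsCoc α) (z) :
    barD4 H (push4 α z) = push3 α (barD4 G z) := by
  suffices h : barD4 H ∘ₗ push4 α = push3 α ∘ₗ barD4 G from LinearMap.congr_fun h z
  refine Finsupp.lhom_ext' fun ⟨a, b, c, d⟩ => LinearMap.ext_ring ?_
  simp only [LinearMap.comp_apply, lsingle_apply, barD4_single, push4_single, map_sum, map_add,
    map_sub, push3_single, Finset.sum_add_distrib, Finset.sum_sub_distrib, mul_smul, hα a b,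
    hα b c, hα c d]
  congr 1
  exact Fintype.sum_equiv (MulAction.toPerm d) _ _ fun x => rfl

/-- prism operator in degree 2 -/
noncomputable def prism2 (α β : G → X → H) (u : X → H) :
    ((G × G) →₀ ℤ) →ₗ[ℤ] ((H × H × H) →₀ ℤ) :=
  Finsupp.lift _ ℤ _ fun t => ∑ x : X,
    (single (u (t.1 • t.2 • x), α t.1 (t.2 • x), α t.2 x) 1
      - single (β t.1 (t.2 • x), u (t.2 • x), α t.2 x) 1
      + single (β t.1 (t.2 • x), β t.2 x, u x) 1)

/-- prism operator in degree 3 -/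
noncomputable def prism3 (α β : G → X → H) (u : X → H) :
    ((G × G × G) →₀ ℤ) →ₗ[ℤ] ((H × H × H × H) →₀ ℤ) :=
  Finsupp.lift _ ℤ _ fun t => ∑ x : X,
    (single (u (t.1 • t.2.1 • t.2.2 • x), α t.1 (t.2.1 • t.2.2 • x), α t.2.1 (t.2.2 • x),
        α t.2.2 x) 1
      - single (β t.1 (t.2.1 • t.2.2 • x), u (t.2.1 • t.2.2 • x), α t.2.1 (t.2.2 • x),
        α t.2.2 x) 1
      + single (β t.1 (t.2.1 • t.2.2 • x), β t.2.1 (t.2.2 • x), u (t.2.2 • x), α t.2.2 x) 1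
      - single (β t.1 (t.2.1 • t.2.2 • x), β t.2.1 (t.2.2 • x), β t.2.2 x, u x) 1)

lemma prism2_single (α β : G → X → H) (u : X → H) (a b : G) :
    prism2 α β u (single (a, b) 1) = ∑ x : X,
    (single (u (a • b • x), α a (b • x), α b x) 1
      - single (β a (b • x), u (b • x), α b x) 1
      + single (β a (b • x), β b x, u x) 1) := by
  simp [prism2]

lemma prism3_single (α β : G → X → H) (u : X → H) (a b c : G) :
    prism3 α β u (single (a, b, c) 1) = ∑ x : X,
    (single (u (a • b • c • x), α a (b • c • x), α b (c • x), α c x) 1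
      - single (β a (b • c • x), u (b • c • x), α b (c • x), α c x) 1
      + single (β a (b • c • x), β b (c • x), u (c • x), α c x) 1
      - single (β a (b • c • x), β b (c • x), β c x, u x) 1) := by
  simp [prism3]

lemma prism {α β : G → X → H} {u : X → H} (hα : IsCoc α) (hβ : IsCoc β)
    (hu : ∀ g x, u (g • x) * α g x = β g x * u x) (z) :
    barD4 H (prism3 α β u z) + prism2 α β u (barD3 G z) = push3 α z - push3 β z := by
  suffices h : barD4 H ∘ₗ prism3 α β u + prism2 α β u ∘ₗ barD3 G = push3 α - push3 β from
    LinearMap.congr_fun h z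
  refine Finsupp.lhom_ext' fun ⟨a, b, c⟩ => LinearMap.ext_ring ?_
  have key (f : X → (H × H × H) →₀ ℤ) : ∑ x : X, f x = ∑ x : X, f (c • x) :=
    (Fintype.sum_equiv (MulAction.toPerm c) _ _ fun x => rfl).symm
  simp only [LinearMap.comp_apply, LinearMap.add_apply, LinearMap.sub_apply, lsingle_apply,
    barD3_single, prism3_single, map_sum, map_add, map_sub, prism2_single, push3_single,
    barD4_single]
  rw [key (fun x => single (u (a • b • x), α a (b • x), α b x) 1
      - single (β a (b • x), u (b • x), α b x) 1
      + single (β a (b • x), β b x, u x) 1)]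
  simp only [← Finset.sum_add_distrib, ← Finset.sum_sub_distrib]
  refine Finset.sum_congr rfl fun x _ => ?_
  simp only [mul_smul, hα a b, hα b c, hβ a b, hβ b c, hu]
  abel

/-- Homotopic cocycles push cycles to homologous cycles. -/
lemma push_homotopic {α β : G → X → H} {u : X → H} (hα : IsCoc α) (hβ : IsCoc β)
    (hu : ∀ g x, u (g • x) * α g x = β g x * u x) (z) (hz : barD3 G z = 0) :
    push3 α z - push3 β z ∈ LinearMap.range (barD4 H) := by
  refine ⟨prism3 α β u z, ?_⟩
  rw [← prism hα hβ hu, hz, map_zero, add_zero]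

end push

section hom

variable {G H : Type*} [Group G] [Group H]

/-- The map on 3-chains induced by a homomorphism. -/
noncomputable def hom3 (f : G →* H) : ((G × G × G) →₀ ℤ) →ₗ[ℤ] ((H × H × H) →₀ ℤ) :=
  Finsupp.lmapDomain ℤ ℤ fun t => (f t.1, f t.2.1, f t.2.2)

lemma hom3_single (f : G →* H) (a b c : G) : hom3 f (single (a, b, c) 1) =
    single (f a, f b, f c) 1 := by
  simp [hom3]

/-- The map on 4-chains induced by a homomorphism. -/
noncomputable def hom4 (f : G →* H) :
    ((G × G × G × G) →₀ ℤ) →ₗ[ℤ] ((H × H × H × H) →₀ ℤ) :=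
  Finsupp.lmapDomain ℤ ℤ fun t => (f t.1, f t.2.1, f t.2.2.1, f t.2.2.2)

/-- The map on 2-chains induced by a homomorphism. -/
noncomputable def hom2 (f : G →* H) : ((G × G) →₀ ℤ) →ₗ[ℤ] ((H × H) →₀ ℤ) :=
  Finsupp.lmapDomain ℤ ℤ fun t => (f t.1, f t.2)

lemma hom2_single (f : G →* H) (a b : G) : hom2 f (single (a, b) 1) = single (f a, f b) 1 := by
  simp [hom2]

lemma hom4_single (f : G →* H) (a b c d : G) : hom4 f (single (a, b, c, d) 1) =
    single (f a, f b, f c, f d) 1 := by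
  simp [hom4]

lemma barD3_hom (f : G →* H) (z) : barD3 H (hom3 f z) = hom2 f (barD3 G z) := by
  suffices h : barD3 H ∘ₗ hom3 f = hom2 f ∘ₗ barD3 G from LinearMap.congr_fun h z
  refine Finsupp.lhom_ext' fun ⟨a, b, c⟩ => LinearMap.ext_ring ?_
  simp only [LinearMap.comp_apply, lsingle_apply, hom3_single, barD3_single, map_add, map_sub,
    hom2_single, map_mul]

lemma barD4_hom (f : G →* H) (z) : barD4 H (hom4 f z) = hom3 f (barD4 G z) := by
  suffices h : barD4 H ∘ₗ hom4 f = hom3 f ∘ₗ barD4 G from LinearMap.congr_fun h z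
  refine Finsupp.lhom_ext' fun ⟨a, b, c, d⟩ => LinearMap.ext_ring ?_
  simp only [LinearMap.comp_apply, lsingle_apply, hom3_single, barD4_single, map_add, map_sub,
    hom4_single, map_mul]

lemma hom3_boundary (f : G →* H) {z} (hz : z ∈ LinearMap.range (barD4 G)) :
    hom3 f z ∈ LinearMap.range (barD4 H) := by
  obtain ⟨y, rfl⟩ := hz
  exact ⟨hom4 f y, barD4_hom f y⟩

lemma hom3_push {X K : Type*} [Group K] [MulAction G X] [Fintype X] (α : G → X → H) (f : H →* K)
    (z) : hom3 f (push3 α z) = push3 (fun g x => f (α g x)) z := by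
  suffices h : hom3 f ∘ₗ push3 α = push3 (fun g x => f (α g x)) from LinearMap.congr_fun h z
  refine Finsupp.lhom_ext' fun ⟨a, b, c⟩ => LinearMap.ext_ring ?_
  simp only [LinearMap.comp_apply, lsingle_apply, push3_single, map_sum, hom3_single]

lemma push_proj {X : Type*} [MulAction G X] [Fintype X] (f : G →* H) (z) :
    push3 (fun g (_ : X) => f g) z = (Fintype.card X : ℤ) • hom3 f z := by
  suffices h : push3 (fun g (_ : X) => f g) = (Fintype.card X : ℤ) • hom3 f from
    LinearMap.congr_fun h z
  refine Finsupp.lhom_ext' fun ⟨a, b, c⟩ => LinearMap.ext_ring ?_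
  simp only [LinearMap.comp_apply, lsingle_apply, push3_single, hom3_single,
    LinearMap.smul_apply]
  simp

lemma hom3_id (z) : hom3 (MonoidHom.id G) z = z := by
  suffices h : hom3 (MonoidHom.id G) = LinearMap.id from LinearMap.congr_fun h z
  refine Finsupp.lhom_ext' fun ⟨a, b, c⟩ => LinearMap.ext_ring ?_
  simp [hom3]

lemma hom3_comp {K : Type*} [Group K] (f : G →* H) (g : H →* K) (z) :
    hom3 (g.comp f) z = hom3 g (hom3 f z) := by
  suffices h : hom3 (g.comp f) = hom3 g ∘ₗ hom3 f from LinearMap.congr_fun h z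
  refine Finsupp.lhom_ext' fun ⟨a, b, c⟩ => LinearMap.ext_ring ?_
  simp [hom3]

/-- Conjugate homomorphisms induce the same map on homology. -/
lemma hom3_conj {f f' : G →* H} (t : H) (h : ∀ g, t * f g = f' g * t) (z) (hz : barD3 G z = 0) :
    hom3 f z - hom3 f' z ∈ LinearMap.range (barD4 H) := by
  let _ : MulAction G Unit :=
    { smul := fun _ x => x, one_smul := fun _ => rfl, mul_smul := fun _ _ _ => rfl }
  have := push_homotopic (X := Unit) (α := fun g _ => f g) (β := fun g _ => f' g) (u := fun _ => t)
    (fun g h x => map_mul f g h) (fun g h x => map_mul f' g h) (fun g x => h g) z hz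
  rw [push_proj, push_proj] at this
  simpa using this

/-- Transfer: `[G : A] z` is homologous to a cycle coming from `A`. -/
lemma transfer [Finite G] {A : Type*} [Group A] (ι : A →* G) (hι : Function.Injective ι) (z)
    (hz : barD3 G z = 0) : ∃ y, barD3 A y = 0 ∧
      (ι.range.index : ℤ) • z - hom3 ι y ∈ LinearMap.range (barD4 G) := by
  classical
  let _ : Fintype (G ⧸ ι.range) := Fintype.ofFinite _
  have h1 (g : G) (x : G ⧸ ι.range) : ∃ a, ι a = (g • x).out⁻¹ * (g * x.out) := by
    have : (g • x).out⁻¹ * (g * x.out) ∈ ι.range := by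
      rw [← QuotientGroup.eq, QuotientGroup.out_eq']
      conv_lhs => rw [← QuotientGroup.out_eq' x]
      rfl
    exact this
  choose α hα using h1
  have hcoc : IsCoc α := by
    intro g h x
    apply hι
    rw [map_mul, hα, hα, hα, mul_smul]
    group
  refine ⟨push3 α z, by rw [barD3_push hcoc, hz, map_zero], ?_⟩
  rw [hom3_push]
  have := push_homotopic (X := G ⧸ ι.range) (α := fun g _ => MonoidHom.id G g)
    (β := fun g x => ι (α g x))
    (u := fun x => x.out⁻¹) (fun g h x => rfl) (fun g h x => by
      simp only [hcoc g h x, map_mul])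
    (fun g x => by simp [hα, mul_assoc]) z hz
  rw [push_proj, hom3_id] at this
  rwa [Subgroup.index, Nat.card_eq_fintype_card]

end hom

end PSLH3

namespace PSLH3

open Finsupp

/-- carry in addition of residues -/
def carry {p : ℕ} (a b : ZMod p) : ℤ := ((a.val : ℤ) + b.val - (a + b).val) / p

lemma carry_spec {p : ℕ} [NeZero p] (a b : ZMod p) :
    (p : ℤ) * carry a b = (a.val : ℤ) + b.val - (a + b).val := by
  apply Int.mul_ediv_cancel'
  rw [← ZMod.intCast_zmod_eq_zero_iff_dvd]
  simp

/-- the standard 3-cocycle of `ℤ/p` with values in `ℤ/p` -/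
noncomputable def phi (p : ℕ) :
    ((Multiplicative (ZMod p) × Multiplicative (ZMod p) × Multiplicative (ZMod p)) →₀ ℤ)
      →ₗ[ℤ] ZMod p :=
  Finsupp.lift _ ℤ _ fun t => t.1.toAdd * (carry t.2.1.toAdd t.2.2.toAdd : ℤ)

lemma phi_single {p : ℕ} (a b c : Multiplicative (ZMod p)) :
    phi p (single (a, b, c) 1) = a.toAdd * (carry b.toAdd c.toAdd : ℤ) := by
  simp [phi]

lemma phi_boundary {p : ℕ} [NeZero p] {z}
    (hz : z ∈ LinearMap.range (barD4 (Multiplicative (ZMod p)))) : phi p z = 0 := by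
  obtain ⟨y, rfl⟩ := hz
  suffices h : phi p ∘ₗ barD4 _ = 0 from LinearMap.congr_fun h y
  refine Finsupp.lhom_ext' fun ⟨a, b, c, d⟩ => LinearMap.ext_ring ?_
  simp only [LinearMap.comp_apply, lsingle_apply, barD4_single, map_add, map_sub, phi_single,
    toAdd_mul, LinearMap.zero_apply]
  generalize a.toAdd = a
  generalize b.toAdd = b
  generalize c.toAdd = c
  generalize d.toAdd = d
  have hp : (p : ℤ) ≠ 0 := by exact_mod_cast NeZero.ne p
  have h : carry c d - carry (b + c) d + carry b (c + d) - carry b c = 0 := by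
    apply mul_left_cancel₀ hp
    have h1 := carry_spec c d
    have h2 := carry_spec (b + c) d
    have h3 := carry_spec b (c + d)
    have h4 := carry_spec b c
    rw [add_assoc] at h2
    linarith
  have h' := congrArg (Int.cast : ℤ → ZMod p) h
  push_cast at h'
  linear_combination -a * h'

/-- multiplication by `k` -/
def mulHom {p : ℕ} (k : ZMod p) : Multiplicative (ZMod p) →* Multiplicative (ZMod p) :=
  AddMonoidHom.toMultiplicative (AddMonoidHom.mulLeft k)

lemma mulHom_apply {p : ℕ} (k : ZMod p) (a : Multiplicative (ZMod p)) :
    mulHom k a = Multiplicative.ofAdd (k * a.toAdd) := rfl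

/-- the explicit 3-cycle -/
noncomputable def cyc (p : ℕ) [NeZero p] :
    (Multiplicative (ZMod p) × Multiplicative (ZMod p) × Multiplicative (ZMod p)) →₀ ℤ :=
  ∑ j : ZMod p, single (.ofAdd 1, .ofAdd j, .ofAdd 1) 1

lemma sum_carry {p : ℕ} [NeZero p] (k : ZMod p) : ∑ j : ZMod p, carry j k = k.val := by
  have hp : (p : ℤ) ≠ 0 := by exact_mod_cast NeZero.ne p
  apply mul_left_cancel₀ hp
  rw [Finset.mul_sum]
  simp only [carry_spec, Finset.sum_add_distrib, Finset.sum_sub_distrib]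
  rw [(Fintype.sum_equiv (Equiv.addRight k) (fun j : ZMod p => (((j + k).val : ℕ) : ℤ))
    (fun j => (j.val : ℤ)) fun x => rfl)]
  simp [ZMod.card]

lemma cyc_cycle (p : ℕ) [NeZero p] : barD3 _ (cyc p) = 0 := by
  simp only [cyc, map_sum, barD3_single, Finset.sum_add_distrib, Finset.sum_sub_distrib,
    ← ofAdd_add]
  rw [(Fintype.sum_equiv (Equiv.addLeft 1)
    (fun j : ZMod p => single ((Multiplicative.ofAdd (1 + j)), Multiplicative.ofAdd 1) (1 : ℤ))
    (fun j => single ((Multiplicative.ofAdd j), Multiplicative.ofAdd 1) (1 : ℤ)) fun x => rfl)]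
  rw [(Fintype.sum_equiv (Equiv.addRight 1)
    (fun j : ZMod p => single ((Multiplicative.ofAdd 1), Multiplicative.ofAdd (j + 1)) (1 : ℤ))
    (fun j => single ((Multiplicative.ofAdd 1), Multiplicative.ofAdd j) (1 : ℤ)) fun x => rfl)]
  abel

lemma phi_mul_cyc {p : ℕ} [Fact p.Prime] (k : ZMod p) (hk : k ≠ 0) :
    phi p (hom3 (mulHom k) (cyc p)) = k ^ 2 := by
  simp only [cyc, map_sum, hom3_single, phi_single, mulHom_apply, toAdd_ofAdd, mul_one]
  rw [← Finset.mul_sum, ← Int.cast_sum,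
    (Fintype.sum_equiv (Equiv.mulLeft₀ k hk) (fun j : ZMod p => carry (k * j) k)
    (fun j => carry j k) fun x => rfl), sum_carry]
  simp [sq]

lemma mulHom_one {p : ℕ} : mulHom (1 : ZMod p) = MonoidHom.id _ := by
  ext a
  simp [mulHom_apply]

lemma phi_cyc {p : ℕ} [Fact p.Prime] : phi p (cyc p) = 1 := by
  have := phi_mul_cyc (p := p) 1 one_ne_zero
  rwa [mulHom_one, hom3_id, one_pow] at this

end PSLH3

namespace PSLH3

open Finsupp CategoryTheory

section cyclic

variable {G : Type} [CommGroup G]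

/-- comparing tuples -/
noncomputable def L2 (G : Type) : ((Fin 2 → G) →₀ ℤ) ≃ₗ[ℤ] ((G × G) →₀ ℤ) :=
  Finsupp.domLCongr ⟨fun f => (f 0, f 1), fun t => ![t.1, t.2],
    fun f => by ext i; fin_cases i <;> rfl, fun t => rfl⟩

/-- comparing tuples -/
noncomputable def L3 (G : Type) : ((Fin 3 → G) →₀ ℤ) ≃ₗ[ℤ] ((G × G × G) →₀ ℤ) :=
  Finsupp.domLCongr ⟨fun f => (f 0, f 1, f 2), fun t => ![t.1, t.2.1, t.2.2],
    fun f => by ext i; fin_cases i <;> rfl, fun t => rfl⟩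

/-- comparing tuples -/
noncomputable def L4 (G : Type) : ((Fin 4 → G) →₀ ℤ) ≃ₗ[ℤ] ((G × G × G × G) →₀ ℤ) :=
  Finsupp.domLCongr ⟨fun f => (f 0, f 1, f 2, f 3), fun t => ![t.1, t.2.1, t.2.2.1, t.2.2.2],
    fun f => by ext i; fin_cases i <;> rfl, fun t => rfl⟩

lemma L2_single (f : Fin 2 → G) (a : ℤ) : L2 G (single f a) = single (f 0, f 1) a := by
  exact Finsupp.domLCongr_single _ _ _

lemma L3_single (f : Fin 3 → G) (a : ℤ) : L3 G (single f a) = single (f 0, f 1, f 2) a := by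
  exact Finsupp.domLCongr_single _ _ _

lemma L4_single (f : Fin 4 → G) (a : ℤ) : L4 G (single f a) = single (f 0, f 1, f 2, f 3) a := by
  exact Finsupp.domLCongr_single _ _ _

lemma d3_compare (z : (Fin 3 → G) →₀ ℤ) :
    barD3 G (L3 G z) =
      L2 G ((groupHomology.inhomogeneousChains.d (Rep.trivial ℤ G ℤ) 2).hom z) := by
  suffices h : barD3 G ∘ₗ (L3 G).toLinearMap = (L2 G).toLinearMap ∘ₗ
      (groupHomology.inhomogeneousChains.d (Rep.trivial ℤ G ℤ) 2).hom from LinearMap.congr_fun h z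
  refine Finsupp.lhom_ext' fun f => LinearMap.ext_ring ?_
  have := groupHomology.inhomogeneousChains.d_single (A := Rep.trivial ℤ G ℤ) 2 f (1 : ℤ)
  simp only [LinearMap.comp_apply, lsingle_apply, LinearEquiv.coe_coe, L3_single, barD3_single]
  erw [this]
  simp only [Fin.sum_univ_succ, map_add, map_smul, map_sum]
  simp [L2_single, Fin.contractNth]
  abel

lemma d4_compare (z : (Fin 4 → G) →₀ ℤ) :
    barD4 G (L4 G z) =
      L3 G ((groupHomology.inhomogeneousChains.d (Rep.trivial ℤ G ℤ) 3).hom z) := by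
  suffices h : barD4 G ∘ₗ (L4 G).toLinearMap = (L3 G).toLinearMap ∘ₗ
      (groupHomology.inhomogeneousChains.d (Rep.trivial ℤ G ℤ) 3).hom from LinearMap.congr_fun h z
  refine Finsupp.lhom_ext' fun f => LinearMap.ext_ring ?_
  have := groupHomology.inhomogeneousChains.d_single (A := Rep.trivial ℤ G ℤ) 3 f (1 : ℤ)
  simp only [LinearMap.comp_apply, lsingle_apply, LinearEquiv.coe_coe, L4_single, barD4_single]
  erw [this]
  simp only [Fin.sum_univ_succ, map_add, map_smul, map_sum]
  simp [L3_single, Fin.contractNth]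
  abel

lemma exists_gen_complex (K : ChainComplex (ModuleCat.{0} ℤ) ℕ) (w : K.homology 3)
    (hw : ∀ y, ∃ n : ℤ, y = n • w) :
    ∃ e : K.X 3, (K.d 3 2).hom e = 0 ∧ ∀ z : K.X 3, (K.d 3 2).hom z = 0 →
      ∃ (n : ℤ) (y : K.X 4), (K.d 4 3).hom y = z - n • e := by
  have hnext : (ComplexShape.down ℕ).next 3 = 2 := by simp
  have hprev : (ComplexShape.down ℕ).prev 3 = 4 := by simp
  obtain ⟨c, rfl⟩ := (ModuleCat.epi_iff_surjective (K.homologyπ 3)).1 inferInstance w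
  refine ⟨(K.iCycles 3).hom c, ?_, fun z hz => ?_⟩
  · exact LinearMap.congr_fun (congrArg ModuleCat.Hom.hom (K.iCycles_d 3 2)) c
  · obtain ⟨z', hz'⟩ : ∃ z', (K.iCycles 3).hom z' = z :=
      ⟨K.cyclesMk z 2 hnext hz, K.i_cyclesMk z 2 hnext hz⟩
    obtain ⟨n, hn⟩ := hw ((K.homologyπ 3).hom z')
    have h0 : (K.homologyπ 3).hom (z' - n • c) = 0 := by
      rw [map_sub, map_zsmul, hn, sub_eq_zero]
    have hex := ShortComplex.exact_of_g_is_cokernel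
      (ShortComplex.mk _ _ (K.toCycles_comp_homologyπ 4 3)) (K.homologyIsCokernel 4 3 hprev)
    rw [ShortComplex.moduleCat_exact_iff] at hex
    obtain ⟨y, hy⟩ := hex (z' - n • c) h0
    refine ⟨n, y, ?_⟩
    have h2 := congrArg (K.iCycles 3).hom hy
    rw [map_sub, map_zsmul, hz'] at h2
    rw [← h2]
    exact (LinearMap.congr_fun (congrArg ModuleCat.Hom.hom (K.toCycles_i 4 3)) y).symm

lemma exists_gen_short (S : ShortComplex (ModuleCat.{0} ℤ)) (a : S.X₂)
    (ha : S.g.hom a = 0) (h : ∀ y : S.X₂, ∃ n : ℤ, y = n • a) :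
    ∃ w : S.homology, ∀ y, ∃ n : ℤ, y = n • w := by
  have hi : Function.Injective S.iCycles.hom :=
    (ModuleCat.mono_iff_injective S.iCycles).1 inferInstance
  have hs : Function.Surjective S.homologyπ.hom :=
    (ModuleCat.epi_iff_surjective S.homologyπ).1 inferInstance
  obtain ⟨b, hb⟩ : ∃ b, S.iCycles.hom b = a := ⟨S.cyclesMk a ha, S.i_cyclesMk a ha⟩
  refine ⟨S.homologyπ.hom b, fun y => ?_⟩
  obtain ⟨y, rfl⟩ := hs y
  obtain ⟨n, hn⟩ := h (S.iCycles.hom y)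
  refine ⟨n, ?_⟩
  rw [← map_zsmul]
  congr 1
  apply hi
  rw [map_zsmul, hn, hb]

lemma exists_gen [Fintype G] (g : G) (hg : ∀ x, x ∈ Subgroup.zpowers g) :
    ∃ w : groupHomology (Rep.trivial ℤ G ℤ) 3, ∀ y, ∃ n : ℤ, y = n • w := by
  classical
  let I := Rep.FiniteCyclicGroup.groupHomologyIsoOdd (Rep.trivial ℤ G ℤ) g hg 3 (by decide)
  obtain ⟨w, hw⟩ := exists_gen_short (Rep.FiniteCyclicGroup.normHomCompSub (Rep.trivial ℤ G ℤ) g)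
    (1 : ℤ) (by simp [Rep.FiniteCyclicGroup.normHomCompSub, Rep.sub_hom, Rep.applyAsHom])
    (fun y => ⟨(y : ℤ), (mul_one (y : ℤ)).symm⟩)
  refine ⟨I.inv.hom w, fun y => ?_⟩
  obtain ⟨n, hn⟩ := hw (I.hom.hom y)
  refine ⟨n, ?_⟩
  rw [← map_zsmul, ← hn]
  exact (LinearMap.congr_fun (congrArg ModuleCat.Hom.hom I.hom_inv_id) y).symm

lemma exists_gen_cycle [Fintype G] (g : G) (hg : ∀ x, x ∈ Subgroup.zpowers g) :
    ∃ e, barD3 G e = 0 ∧ ∀ z, barD3 G z = 0 →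
      ∃ n : ℤ, z - n • e ∈ LinearMap.range (barD4 G) := by
  obtain ⟨w, hw⟩ := exists_gen g hg
  obtain ⟨e, he, h⟩ := exists_gen_complex
    (groupHomology.inhomogeneousChains (Rep.trivial ℤ G ℤ)) w hw
  rw [groupHomology.inhomogeneousChains.d_def, groupHomology.inhomogeneousChains.d_def] at h
  rw [groupHomology.inhomogeneousChains.d_def] at he
  refine ⟨L3 G e, ?_, fun z hz => ?_⟩
  · rw [d3_compare, LinearEquiv.map_eq_zero_iff]
    exact he
  · obtain ⟨z, rfl⟩ := (L3 G).surjective z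
    rw [d3_compare, LinearEquiv.map_eq_zero_iff] at hz
    obtain ⟨n, y, hy⟩ := h z hz
    refine ⟨n, L4 G y, ?_⟩
    rw [d4_compare, ← map_zsmul, ← map_sub]
    exact congrArg (L3 G) hy

end cyclic

end PSLH3

namespace PSLH3

open Finsupp

section main

variable {p : ℕ} [Fact p.Prime]

/-- Multiplication by `k` acts on a generator of `H₃(ℤ/p)` by an integer congruent to `k ^ 2`. -/
lemma mulHom_gen (k : ZMod p) (hk : k ≠ 0) :
    ∃ (e : _) (m : ℤ), barD3 (Multiplicative (ZMod p)) e = 0 ∧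
      (∀ z, barD3 (Multiplicative (ZMod p)) z = 0 →
        ∃ n : ℤ, z - n • e ∈ LinearMap.range (barD4 (Multiplicative (ZMod p)))) ∧
      hom3 (mulHom k) e - m • e ∈ LinearMap.range (barD4 (Multiplicative (ZMod p))) ∧
      (m : ZMod p) = k ^ 2 := by
  obtain ⟨e, he, hgen⟩ := exists_gen_cycle (G := Multiplicative (ZMod p)) (.ofAdd 1) (by
    intro x
    refine ⟨(x.toAdd.val : ℤ), ?_⟩
    apply Multiplicative.toAdd.injective
    simp)
  obtain ⟨m, hm⟩ := hgen (hom3 (mulHom k) e) (by rw [barD3_hom, he, map_zero])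
  refine ⟨e, m, he, hgen, hm, ?_⟩
  obtain ⟨c, hc⟩ := hgen (cyc p) (cyc_cycle p)
  have h1 := phi_boundary hc
  have h2 := phi_boundary (hom3_boundary (mulHom k) hc)
  have h3 := phi_boundary hm
  simp only [map_sub, map_zsmul, phi_cyc, phi_mul_cyc k hk, zsmul_eq_mul] at h1 h2 h3
  linear_combination m * h1 - h2 - c * h3

/-- The abstract argument. -/
lemma no_torsion {G : Type*} [Group G] [Finite G] (ι : Multiplicative (ZMod p) →* G)
    (hι : Function.Injective ι) (hidx : ¬ p ∣ ι.range.index) (t : G) (k : ZMod p) (hk : k ≠ 0)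
    (hk2 : k ^ 2 ≠ 1) (ht : ∀ u, t * ι u = ι (mulHom k u) * t)
    (z) (hz : barD3 G z = 0) (hpz : (p : ℤ) • z ∈ LinearMap.range (barD4 G)) :
    z ∈ LinearMap.range (barD4 G) := by
  obtain ⟨e, m, he, hgen, hm, hmk⟩ := mulHom_gen k hk
  obtain ⟨y, hy, hzy⟩ := transfer ι hι z hz
  obtain ⟨n, hn⟩ := hgen y hy
  have h1 := hom3_boundary ι hn
  have h2 := hom3_boundary ι hm
  have h3 := hom3_conj (f := ι) (f' := ι.comp (mulHom k)) t ht e he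
  rw [hom3_comp] at h3
  simp only [map_sub, map_zsmul] at h1 h2
  set R := LinearMap.range (barD4 G)
  -- `(m - 1) • ι e` is a boundary
  have h4 : (m - 1) • hom3 ι e ∈ R := by
    have := R.neg_mem (R.add_mem h2 h3)
    convert this using 1
    module
  have h5 : ((m - 1) * ι.range.index) • z ∈ R := by
    have := R.add_mem (R.add_mem (R.smul_mem (m - 1) hzy) (R.smul_mem (m - 1) h1))
      (R.smul_mem n h4)
    convert this using 1
    module
  have hcop : IsCoprime (p : ℤ) ((m - 1) * ι.range.index) := by
    have hp : Prime (p : ℤ) := Nat.prime_iff_prime_int.1 Fact.out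
    rw [hp.irreducible.coprime_iff_not_dvd]
    intro h
    rcases hp.dvd_or_dvd h with h | h
    · rw [← ZMod.intCast_zmod_eq_zero_iff_dvd] at h
      push_cast at h
      rw [hmk] at h
      exact hk2 (sub_eq_zero.1 h)
    · exact hidx (Int.natCast_dvd_natCast.1 h)
  obtain ⟨a, b, hab⟩ := hcop
  have := R.add_mem (R.smul_mem a hpz) (R.smul_mem b h5)
  rw [smul_smul, smul_smul, ← add_smul, hab, one_smul] at this
  exact this

open Matrix in
/-- upper unipotent matrices -/
def uni (p : ℕ) : Multiplicative (ZMod p) →* SpecialLinearGroup (Fin 2) (ZMod p) where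
  toFun u := ⟨!![1, u.toAdd; 0, 1], by simp⟩
  map_one' := by
    ext i j
    fin_cases i <;> fin_cases j <;> simp
  map_mul' u v := by
    apply Subtype.ext
    change !![1, u.toAdd + v.toAdd; 0, 1] = !![1, u.toAdd; 0, 1] * !![1, v.toAdd; 0, 1]
    simp [add_comm]

/-- The unipotent subgroup of `PSL₂`. -/
def iota (p : ℕ) : Multiplicative (ZMod p) →* PSL2 p := (QuotientGroup.mk' _).comp (uni p)

lemma iota_injective : Function.Injective (iota p) := by
  rw [injective_iff_map_eq_one]
  intro u hu
  have hu' : uni p u ∈ Subgroup.center _ := (QuotientGroup.eq_one_iff _).1 hu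
  rw [Subgroup.mem_center_iff] at hu'
  have := hu' ⟨!![1, 0; 1, 1], by simp⟩
  have h2 : !![1, 0; 1, 1] * !![1, u.toAdd; 0, 1] = !![1, u.toAdd; 0, 1] * !![1, 0; 1, 1] :=
    congrArg Subtype.val this
  rw [Matrix.mul_fin_two, Matrix.mul_fin_two] at h2
  have h3 := congrFun (congrFun h2 0) 0
  simp at h3
  exact h3

lemma uni_index : ¬ p ∣ (uni p).range.index := by
  have hp : p.Prime := Fact.out
  have hsm : ∀ (g : Matrix.SpecialLinearGroup (Fin 2) (ZMod p)),
      g • (![1, 0] : Fin 2 → ZMod p) = ![g.1 0 0, g.1 1 0] := by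
    intro g
    change g.1.mulVec ![1, 0] = _
    ext i
    fin_cases i <;> simp [Matrix.mulVec, dotProduct, Fin.sum_univ_two]
  have hstab : MulAction.stabilizer (Matrix.SpecialLinearGroup (Fin 2) (ZMod p))
      (![1, 0] : Fin 2 → ZMod p) = (uni p).range := by
    ext g
    rw [MulAction.mem_stabilizer_iff, hsm, MonoidHom.mem_range]
    constructor
    · intro h
      have h0 : g.1 0 0 = 1 := congrFun h 0
      have h1 : g.1 1 0 = 0 := congrFun h 1
      have hd := g.2
      rw [Matrix.det_fin_two, h0, h1] at hd
      have h2 : g.1 1 1 = 1 := by simpa using hd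
      refine ⟨.ofAdd (g.1 0 1), Subtype.ext ?_⟩
      change !![1, g.1 0 1; 0, 1] = g.1
      rw [Matrix.eta_fin_two g.1, h0, h1, h2]
      simp
    · rintro ⟨u, rfl⟩
      rfl
  have horb : MulAction.orbit (Matrix.SpecialLinearGroup (Fin 2) (ZMod p))
      (![1, 0] : Fin 2 → ZMod p) = {0}ᶜ := by
    ext v
    simp only [MulAction.mem_orbit_iff, hsm, Set.mem_compl_iff, Set.mem_singleton_iff]
    constructor
    · rintro ⟨g, rfl⟩ h
      have h0 : g.1 0 0 = 0 := congrFun h 0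
      have h1 : g.1 1 0 = 0 := congrFun h 1
      have hd := g.2
      rw [Matrix.det_fin_two, h0, h1] at hd
      simp at hd
    · intro hv
      by_cases h0 : v 0 = 0
      · have h1 : v 1 ≠ 0 := by
          intro h1
          apply hv
          ext i
          fin_cases i
          · exact h0
          · exact h1
        refine ⟨⟨!![v 0, -(v 1)⁻¹; v 1, 0], ?_⟩, ?_⟩
        · rw [Matrix.det_fin_two_of]
          field_simp
          ring
        · ext i
          fin_cases i <;> rfl
      · refine ⟨⟨!![v 0, 0; v 1, (v 0)⁻¹], ?_⟩, ?_⟩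
        · rw [Matrix.det_fin_two_of]
          field_simp
          ring
        · ext i
          fin_cases i <;> rfl
  rw [← hstab, MulAction.index_stabilizer, horb]
  have hc := Set.ncard_add_ncard_compl ({0} : Set (Fin 2 → ZMod p))
  rw [Set.ncard_singleton, Nat.card_eq_fintype_card, Fintype.card_fun, ZMod.card,
    Fintype.card_fin] at hc
  intro h
  have h2 : p ∣ 1 := (Nat.dvd_add_left h).1 (hc ▸ dvd_pow_self p two_ne_zero)
  exact hp.one_lt.ne' (Nat.dvd_one.1 h2)

lemma iota_index : ¬ p ∣ (iota p).range.index := by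
  intro h
  apply uni_index (p := p)
  refine h.trans ?_
  have h1 : (iota p).range = (uni p).range.map (QuotientGroup.mk' _) := by
    rw [iota, MonoidHom.range_comp]
  rw [h1]
  exact Subgroup.index_map_dvd _ (QuotientGroup.mk'_surjective _)

lemma exists_unit (hp : 7 ≤ p) : ∃ a : (ZMod p)ˣ, a ^ 4 ≠ 1 := by
  obtain ⟨g, hg⟩ := IsCyclic.exists_generator (α := (ZMod p)ˣ)
  refine ⟨g, fun h => ?_⟩
  have h1 := orderOf_dvd_of_pow_eq_one h
  rw [orderOf_eq_card_of_forall_mem_zpowers hg, Nat.card_eq_fintype_card,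
    ZMod.card_units] at h1
  have := Nat.le_of_dvd (by norm_num) h1
  omega

end main

end PSLH3

/-- For a prime `p ≥ 7`, the third integral homology `H₃(PSL₂(F_p); ℤ)` contains no
element of order `p`. -/
theorem psl2_H3_no_p_torsion (p : ℕ) [Fact p.Prime] (hp : 7 ≤ p) :
    ¬ ∃ x : H3 (PSL2 p), addOrderOf x = p := by
  rintro ⟨x, hx⟩
  obtain ⟨a, ha⟩ := PSLH3.exists_unit hp
  have hpx : p • x = 0 := by
    have := addOrderOf_nsmul_eq_zero x
    rwa [hx] at this
  obtain ⟨⟨z, hz⟩, hzx⟩ := Submodule.Quotient.mk_surjective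
    (Submodule.comap (LinearMap.ker (barD3 (PSL2 p))).subtype
      (LinearMap.range (barD4 (PSL2 p)))) x
  have hdet : Matrix.det !![(a : ZMod p), 0; 0, ((a⁻¹ : (ZMod p)ˣ) : ZMod p)] = 1 := by
    rw [Matrix.det_fin_two_of, Units.mul_inv, mul_zero, sub_zero]
  let d : Matrix.SpecialLinearGroup (Fin 2) (ZMod p) := ⟨_, hdet⟩
  have hpz' : (p : ℤ) • z ∈ LinearMap.range (barD4 (PSL2 p)) := by
    subst hzx
    let K := LinearMap.ker (barD3 (PSL2 p))
    let N := Submodule.comap K.subtype (LinearMap.range (barD4 (PSL2 p)))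
    have h1 : p • (Submodule.Quotient.mk ⟨z, hz⟩ : K ⧸ N) = 0 := hpx
    rw [← Submodule.Quotient.mk_smul, Submodule.Quotient.mk_eq_zero] at h1
    have this : p • z ∈ LinearMap.range (barD4 (PSL2 p)) := h1
    simpa using this
  have hz0 := PSLH3.no_torsion (PSLH3.iota p) PSLH3.iota_injective PSLH3.iota_index
    (QuotientGroup.mk' _ d) ((a : ZMod p) ^ 2) (pow_ne_zero _ a.ne_zero) (by
      intro h
      apply ha
      ext
      push_cast
      rw [← h]
      ring) (by
      intro u
      rw [PSLH3.iota, MonoidHom.comp_apply, MonoidHom.comp_apply, ← map_mul, ← map_mul]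
      congr 1
      apply Subtype.ext
      change !![(a : ZMod p), 0; 0, ((a⁻¹ : (ZMod p)ˣ) : ZMod p)] * !![1, u.toAdd; 0, 1] =
        !![1, (PSLH3.mulHom ((a : ZMod p) ^ 2) u).toAdd; 0, 1] *
          !![(a : ZMod p), 0; 0, ((a⁻¹ : (ZMod p)ˣ) : ZMod p)]
      have h1 : (PSLH3.mulHom ((a : ZMod p) ^ 2) u).toAdd = (a : ZMod p) ^ 2 * u.toAdd := rfl
      have h2 : (a : ZMod p) ^ 2 * u.toAdd * ((a⁻¹ : (ZMod p)ˣ) : ZMod p) = a * u.toAdd := by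
        linear_combination (a : ZMod p) * u.toAdd * a.mul_inv
      rw [h1, Matrix.mul_fin_two, Matrix.mul_fin_two]
      simp only [mul_one, mul_zero, zero_mul, one_mul, add_zero, zero_add, h2]) z hz hpz'
  have h0 : x = 0 := by
    rw [← hzx]
    exact (Submodule.Quotient.mk_eq_zero _).2 hz0
  rw [h0, addOrderOf_zero] at hx
  omega
end

section
/- For a prime p ≥ 7, if φ : Z/p → PSL₂(F_p) is injective, then the induced map on third integral homology H₃(Z/p; ℤ) → H₃(PSL₂(F_p); ℤ) is the zero map. -/
open Finsupp in
/-- The map on degree-3 bar chains induced by a group homomorphism `φ : G → K`. -/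
noncomputable def barMap3 {G K : Type*} [Group G] [Group K] (φ : G →* K) :
    ((G × G × G) →₀ ℤ) →ₗ[ℤ] ((K × K × K) →₀ ℤ) :=
  Finsupp.lift _ ℤ _ fun t => single (φ t.1, φ t.2.1, φ t.2.2) 1

/-- Abstract relation satisfied by the classes of bar 3-chains modulo boundaries. -/
def BarRel {M Q : Type*} [Mul M] [AddCommGroup Q] (T : M → M → M → Q) : Prop :=
  ∀ a b c d, T b c d - T (a * b) c d + T a (b * c) d - T a b (c * d) + T a b c = 0

def BarRelAdd {M Q : Type*} [Add M] [AddCommGroup Q] (T : M → M → M → Q) : Prop :=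
  ∀ a b c d, T b c d - T (a + b) c d + T a (b + c) d - T a b (c + d) + T a b c = 0

/-- Conjugation is homotopic to the identity. -/
lemma barRel_conj {K Q : Type*} [Group K] [AddCommGroup Q] {T : K → K → K → Q}
    (hT : BarRel T) (g : K) : ∃ L : K → K → Q, ∀ a b c,
      T (g * a * g⁻¹) (g * b * g⁻¹) (g * c * g⁻¹) - T a b c =
        L b c - L (a * b) c + L a (b * c) - L a b := by
  have key : ∃ L : K → K → Q, ∀ a b c,
      T (g * a * g⁻¹) (g * b * g⁻¹) (g * c * g⁻¹) - T a b c =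
        -(L b c - L (a * b) c + L a (b * c) - L a b) := by
    refine ⟨fun a b => T g a b - T (g * a * g⁻¹) g b + T (g * a * g⁻¹) (g * b * g⁻¹) g, ?_⟩
    intro a b c
    have h1 := hT g a b c
    have h2 := hT (g * a * g⁻¹) g b c
    have h3 := hT (g * a * g⁻¹) (g * b * g⁻¹) g c
    have h4 := hT (g * a * g⁻¹) (g * b * g⁻¹) (g * c * g⁻¹) g
    have e1 : ∀ x, g * x * g⁻¹ * g = g * x := fun x => by group
    have e2 : ∀ x y, g * x * g⁻¹ * (g * y * g⁻¹) = g * (x * y) * g⁻¹ := fun x y => by group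
    simp only [e1, e2] at h1 h2 h3 h4
    rw [← sub_eq_zero]
    have h : ∀ {x y z w : Q}, x = 0 → y = 0 → z = 0 → w = 0 → x - y + z - w = 0 := by
      rintro _ _ _ _ rfl rfl rfl rfl; simp
    rw [← h h4 h3 h2 h1]
    dsimp only
    simp only [sub_eq_add_neg, neg_add, neg_neg]
    abel
  obtain ⟨L, hL⟩ := key
  refine ⟨fun a b => - L a b, fun a b c => ?_⟩
  rw [hL]; simp only [sub_eq_add_neg, neg_add, neg_neg]

section cyc
variable {p : ℕ} [Fact p.Prime] {Q : Type*} [AddCommGroup Q] {T : ZMod p → ZMod p → ZMod p → Q}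

lemma W_left (hT : BarRelAdd T) (a b d : ZMod p) :
    ∑ i, T (a + b) i d = ∑ i, T a i d + ∑ i, T b i d := by
  have h : ∑ i, (T b i d - T (a + b) i d + T a (b + i) d - T a b (i + d) + T a b i) = 0 :=
    Finset.sum_eq_zero fun i _ => hT a b i d
  simp only [Finset.sum_add_distrib, Finset.sum_sub_distrib] at h
  have e1 : ∑ i, T a (b + i) d = ∑ i, T a i d :=
    Equiv.sum_comp (Equiv.addLeft b) (fun i => T a i d)
  have e2 : ∑ i, T a b (i + d) = ∑ i, T a b i :=
    Equiv.sum_comp (Equiv.addRight d) (fun i => T a b i)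
  rw [e1, e2] at h
  rw [← sub_eq_zero, ← neg_eq_zero, ← h]; abel

lemma W_right (hT : BarRelAdd T) (a c d : ZMod p) :
    ∑ i, T a i (c + d) = ∑ i, T a i c + ∑ i, T a i d := by
  have h : ∑ i, (T i c d - T (a + i) c d + T a (i + c) d - T a i (c + d) + T a i c) = 0 :=
    Finset.sum_eq_zero fun i _ => hT a i c d
  simp only [Finset.sum_add_distrib, Finset.sum_sub_distrib] at h
  have e1 : ∑ i, T a (i + c) d = ∑ i, T a i d :=
    Equiv.sum_comp (Equiv.addRight c) (fun i => T a i d)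
  have e2 : ∑ i, T (a + i) c d = ∑ i, T i c d :=
    Equiv.sum_comp (Equiv.addLeft a) (fun i => T i c d)
  rw [e1, e2] at h
  rw [← sub_eq_zero, ← neg_eq_zero, ← h]; abel

/-- `∑ i, T a i d` as a biadditive map. -/
def Wmap (hT : BarRelAdd T) : ZMod p →+ ZMod p →+ Q :=
  AddMonoidHom.mk' (fun a => AddMonoidHom.mk' (fun d => ∑ i, T a i d) (W_right hT a))
    (fun a b => by ext d; exact W_left hT a b d)

lemma Wmap_apply (hT : BarRelAdd T) (a d : ZMod p) : Wmap hT a d = ∑ i, T a i d := rfl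

lemma W_torsion (hT : BarRelAdd T) (a d : ZMod p) : p • Wmap hT a d = 0 := by
  rw [← map_nsmul]; simp

lemma W_four (hT : BarRelAdd T) (hp : 7 ≤ p) (h : Wmap hT 4 4 = Wmap hT 1 1) :
    Wmap hT 1 1 = 0 := by
  have e4 : (4 : ZMod p) = 4 • (1 : ZMod p) := by simp
  have h16 : Wmap hT 4 4 = 16 • Wmap hT 1 1 := by
    rw [e4, map_nsmul, map_nsmul, AddMonoidHom.nsmul_apply, smul_smul]
    rfl
  have h15 : 15 • Wmap hT 1 1 = 0 := by
    have : 16 • Wmap hT 1 1 = 15 • Wmap hT 1 1 + Wmap hT 1 1 := by rw [← succ_nsmul]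
    rw [← h16, h] at this
    simpa using this.symm
  have hpp := W_torsion hT 1 1
  have hprime : p.Prime := Fact.out
  have hcop : Nat.Coprime p 15 := by
    rw [Nat.Prime.coprime_iff_not_dvd hprime]
    intro hd
    have : p ∣ 3 * 5 := hd
    rcases (Nat.Prime.dvd_mul hprime).1 this with h | h
    · have := Nat.le_of_dvd (by norm_num) h; omega
    · have := Nat.le_of_dvd (by norm_num) h; omega
  have d1 := addOrderOf_dvd_of_nsmul_eq_zero hpp
  have d2 := addOrderOf_dvd_of_nsmul_eq_zero h15
  have := Nat.dvd_gcd d1 d2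
  rw [hcop] at this
  exact AddMonoid.addOrderOf_eq_one_iff.1 (Nat.dvd_one.1 this)

lemma W_zero (hT : BarRelAdd T) (h : Wmap hT 1 1 = 0) (d : ZMod p) : ∑ i, T 1 i d = 0 := by
  rw [← Wmap_apply hT]
  have : d = d.val • (1 : ZMod p) := by simp
  rw [this, map_nsmul, h, smul_zero]

/-- A function on `ZMod p` with zero sum has a primitive. -/
lemma exists_primitive (u : ZMod p → Q) (h : ∑ i, u i = 0) :
    ∃ U : ZMod p → Q, U 0 = 0 ∧ ∀ a, U (a + 1) = U a + u a := by
  have hprime : p.Prime := Fact.out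
  have hs : ∑ i ∈ Finset.range p, u (i : ZMod p) = 0 := by
    rw [← h]
    refine Finset.sum_bij' (fun i _ => (i : ZMod p)) (fun a _ => a.val) ?_ ?_ ?_ ?_ ?_
    · simp
    · intro a _; simpa using ZMod.val_lt a
    · intro i hi; exact ZMod.val_cast_of_lt (Finset.mem_range.1 hi)
    · intro a _; simp
    · simp
  refine ⟨fun a => ∑ i ∈ Finset.range a.val, u (i : ZMod p), by simp, fun a => ?_⟩
  have ha := ZMod.val_lt a
  have e : (∑ i ∈ Finset.range a.val, u (i : ZMod p)) + u a
      = ∑ i ∈ Finset.range (a.val + 1), u (i : ZMod p) := by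
    rw [Finset.sum_range_succ]; simp
  show _ = (∑ i ∈ Finset.range a.val, u (i : ZMod p)) + u a
  rw [e]
  have hcast : a + 1 = ((a.val + 1 : ℕ) : ZMod p) := by simp
  rcases Nat.lt_or_ge (a.val + 1) p with hlt | hge
  · have hv : (a + 1).val = a.val + 1 := by rw [hcast, ZMod.val_cast_of_lt hlt]
    simp only [hv]
  · have : a.val + 1 = p := by omega
    rw [this, hs]
    have : a + 1 = 0 := by rw [hcast, this]; simp
    simp [this]

lemma exists_H (hT : BarRelAdd T) (h : ∀ d, ∑ i, T 1 i d = 0) :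
    ∃ H : ZMod p → ZMod p → Q, ∀ a c d,
      T a c d = H c d - H (a + c) d + H a (c + d) - H a c := by
  choose U hU0 hU1 using fun d => exists_primitive (fun i => T 1 i d) (h d)
  have main : ∀ c d (n : ℕ), T n c d = T 0 0 (c + d) - T 0 0 c + U d (n + c) - U d c
      - U (c + d) n + U c n := by
    intro c d n
    induction n with
    | zero =>
      have := hT 0 0 c d
      simp only [add_zero, zero_add] at this
      simp only [Nat.cast_zero, hU0, zero_add]
      rw [← sub_eq_zero, ← this]; abel
    | succ n ih =>
      have := hT 1 n c d
      have e1 : ((n + 1 : ℕ) : ZMod p) = n + 1 := by push_cast; rfl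
      have e2 : (n : ZMod p) + 1 + c = (n + c) + 1 := by ring
      rw [e1, e2, hU1, hU1, hU1]
      rw [add_comm 1 (n : ZMod p), ih] at this
      rw [← sub_eq_zero, ← neg_eq_zero, ← this]; abel
  refine ⟨fun a c => T 0 0 c - U c a, fun a c d => ?_⟩
  have := main c d a.val
  simp only [ZMod.natCast_val, ZMod.cast_id', id] at this
  rw [this]; simp only [sub_eq_add_neg, neg_add, neg_neg]; abel

end cyc

section groups
open Matrix

lemma exists_conj_nilp {F : Type*} [Field F] (h2 : (2 : F) ≠ 0) (N : Matrix (Fin 2) (Fin 2) F)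
    (ht : N 1 1 = - N 0 0) (hd : N 0 0 * N 0 0 + N 0 1 * N 1 0 = 0) :
    ∃ g : Matrix.SpecialLinearGroup (Fin 2) F, (g : Matrix _ _ F) * N = (4 : ℕ) • (N * (g : Matrix _ _ F)) := by
  by_cases hc : N 1 0 = 0
  · have ha : N 0 0 = 0 := by simpa [hc] using hd
    refine ⟨⟨!![2, 0; 0, 2⁻¹], by simp [Matrix.det_fin_two, h2]⟩, ?_⟩
    ext i j
    fin_cases i <;> fin_cases j <;> simp [Matrix.mul_apply, Fin.sum_univ_two, ht, ha, hc]
    field_simp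
    ring
  · have hb : N 0 1 = - (N 0 0 * N 0 0) / N 1 0 := by
      field_simp
      linear_combination hd
    refine ⟨⟨!![2⁻¹, 3 * N 0 0 / (2 * N 1 0); 0, 2], by simp [Matrix.det_fin_two, h2]⟩, ?_⟩
    ext i j
    fin_cases i <;> fin_cases j <;> simp [Matrix.mul_apply, Fin.sum_univ_two, ht, hb] <;>
      field_simp <;> ring

lemma psl_conj (p : ℕ) [Fact p.Prime] (hp : 7 ≤ p) (x : PSL2 p) (hx : x ^ p = 1) :
    ∃ g : PSL2 p, g * x * g⁻¹ = x ^ 4 := by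
  have hprime : p.Prime := Fact.out
  obtain ⟨A, rfl⟩ := QuotientGroup.mk_surjective x
  rw [← QuotientGroup.mk_pow, QuotientGroup.eq_one_iff,
    Matrix.SpecialLinearGroup.mem_center_iff] at hx
  obtain ⟨r, hr, hA⟩ := hx
  simp only [Fintype.card_fin] at hr
  set M : Matrix (Fin 2) (Fin 2) (ZMod p) := A.1 with hM
  set N := M - Matrix.scalar (Fin 2) r with hN
  have hNp : N ^ p = 0 := by
    have hcomm : Commute M (Matrix.scalar (Fin 2) r) :=
      (Matrix.scalar_commute r (fun r' => Commute.all _ _) M).symm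
    rw [hN, sub_pow_char_of_commute _ hcomm, ← map_pow, ZMod.pow_card, hA]
    simp [hM]
  have hnil : IsNilpotent N := ⟨p, hNp⟩
  have htr : N.trace = 0 := (Matrix.isNilpotent_trace_of_isNilpotent hnil).eq_zero
  have hdet : N.det = 0 := by
    have : N.det ^ p = 0 := by rw [← Matrix.det_pow, hNp]; simp
    exact pow_eq_zero_iff hprime.ne_zero |>.1 this
  rw [Matrix.trace_fin_two] at htr
  rw [Matrix.det_fin_two] at hdet
  have ht : N 1 1 = - N 0 0 := by linear_combination htr
  have hd : N 0 0 * N 0 0 + N 0 1 * N 1 0 = 0 := by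
    rw [ht] at hdet; linear_combination -hdet
  have h2 : (2 : ZMod p) ≠ 0 := by
    have : ((2 : ℕ) : ZMod p) ≠ 0 := by
      rw [Ne, ZMod.natCast_eq_zero_iff]
      intro h; have := Nat.le_of_dvd (by norm_num) h; omega
    simpa using this
  obtain ⟨g, hg⟩ := exists_conj_nilp h2 N ht hd
  have hNN : N * N = 0 := by
    ext i j
    fin_cases i <;> fin_cases j <;> simp [Matrix.mul_apply, Fin.sum_univ_two, ht] <;>
      first | ring1 | linear_combination hd
  set S := Matrix.scalar (Fin 2) r with hS
  have hSS : S * S = 1 := by rw [hS, ← map_mul, ← pow_two, hr, map_one]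
  have hcS : ∀ X : Matrix (Fin 2) (Fin 2) (ZMod p), S * X = X * S := fun X =>
    (Matrix.scalar_commute r (fun r' => Commute.all _ _) X)
  have hMN : M = S + N := by rw [hN]; abel
  -- the central element
  let s : Matrix.SpecialLinearGroup (Fin 2) (ZMod p) := ⟨S, by
    rw [hS]; simp [Matrix.det_fin_two, ← pow_two, hr]⟩
  have hs : s ∈ Subgroup.center (Matrix.SpecialLinearGroup (Fin 2) (ZMod p)) := by
    rw [Matrix.SpecialLinearGroup.mem_center_iff]
    exact ⟨r, by simpa using hr, rfl⟩
  have hM2 : M * M = 1 + 2 • (S * N) := by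
    rw [hMN, add_mul, mul_add, mul_add, hSS, hNN, ← hcS N, two_smul]; abel
  have hM4 : M ^ 4 = 1 + 4 • (S * N) := by
    have hz : S * N * (S * N) = 0 := by
      rw [mul_assoc, ← mul_assoc N, ← hcS N, mul_assoc S N N, hNN]; simp
    have : M ^ 4 = (M * M) * (M * M) := by noncomm_ring
    rw [this, hM2, add_mul, mul_add, mul_add]
    simp only [mul_one, one_mul, smul_mul_smul_comm, hz, smul_zero, add_zero]
    abel
  have hfin : s * (g * A) = A ^ 4 * g := by
    apply Subtype.ext
    show S * ((g : Matrix _ _ _) * M) = M ^ 4 * (g : Matrix _ _ _)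
    rw [hM4, add_mul, hMN, mul_add, hg, mul_add, ← hcS (g : Matrix _ _ _), ← mul_assoc, hSS]
    simp only [one_mul, smul_mul_assoc, mul_smul_comm, mul_assoc]
  refine ⟨(g : PSL2 p), ?_⟩
  rw [mul_inv_eq_iff_eq_mul]
  have h1 : ((s * (g * A) : Matrix.SpecialLinearGroup (Fin 2) (ZMod p)) : PSL2 p)
      = ((A ^ 4 * g : Matrix.SpecialLinearGroup (Fin 2) (ZMod p)) : PSL2 p) := by rw [hfin]
  have h3 : ((s : Matrix.SpecialLinearGroup (Fin 2) (ZMod p)) : PSL2 p) = 1 :=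
    (QuotientGroup.eq_one_iff s).2 hs
  rw [QuotientGroup.mk_mul, h3, one_mul] at h1
  exact h1

end groups

/-- The class of a bar 3-simplex modulo boundaries. -/
noncomputable def barT (K : Type*) [Group K] (a b c : K) :
    ((K × K × K) →₀ ℤ) ⧸ LinearMap.range (barD4 K) :=
  Submodule.Quotient.mk (Finsupp.single (a, b, c) 1)

lemma barT_rel (K : Type*) [Group K] : BarRel (barT K) := by
  intro a b c d
  simp only [barT, ← Submodule.Quotient.mk_sub, ← Submodule.Quotient.mk_add]
  rw [Submodule.Quotient.mk_eq_zero]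
  exact ⟨Finsupp.single (a, b, c, d) 1, by simp [barD4]⟩

/-- For a prime `p ≥ 7` and an injective homomorphism `φ : ℤ/p → PSL₂(F_p)`, the induced
map `H₃(ℤ/p; ℤ) → H₃(PSL₂(F_p); ℤ)` is zero: every 3-cycle of `ℤ/p` is sent by the induced
chain map to a 3-boundary of `PSL₂(F_p)`. -/
theorem zmodp_to_psl2_H3_map_zero (p : ℕ) [Fact p.Prime] (hp : 7 ≤ p)
    (φ : Multiplicative (ZMod p) →* PSL2 p) (hφ : Function.Injective φ) :
    ∀ x : (Multiplicative (ZMod p) × Multiplicative (ZMod p) × Multiplicative (ZMod p)) →₀ ℤ,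
      barD3 (Multiplicative (ZMod p)) x = 0 →
      ∃ w, barMap3 φ x = barD4 (PSL2 p) w := by
  intro x hx
  have hprime : p.Prime := Fact.out
  let f : ZMod p → PSL2 p := fun a => φ (Multiplicative.ofAdd a)
  have hf : ∀ a b, f (a + b) = f a * f b := fun a b => by simp [f, ofAdd_add]
  have hfn : ∀ (n : ℕ) a, f (n * a) = f a ^ n := fun n a => by
    rw [← nsmul_eq_mul]; simp only [f, ofAdd_nsmul, map_pow]
  let T : ZMod p → ZMod p → ZMod p → _ := fun a b c => barT (PSL2 p) (f a) (f b) (f c)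
  have hT : BarRelAdd T := by
    intro a b c d
    simp only [T, hf]
    exact barT_rel (PSL2 p) (f a) (f b) (f c) (f d)
  obtain ⟨g, hg⟩ := psl_conj p hp (f 1) (by rw [← hfn p 1]; simp [f])
  have hga : ∀ a, g * f a * g⁻¹ = f (4 * a) := by
    intro a
    have ha : f a = f 1 ^ a.val := by rw [← hfn]; simp
    rw [ha, ← conj_pow, hg, ← pow_mul, ← hfn]
    simp
  obtain ⟨L, hL⟩ := barRel_conj (barT_rel (PSL2 p)) g
  have h4 : (4 : ZMod p) ≠ 0 := by
    have : ((4 : ℕ) : ZMod p) ≠ 0 := by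
      rw [Ne, ZMod.natCast_eq_zero_iff]
      intro h; have := Nat.le_of_dvd (by norm_num) h; omega
    simpa using this
  have hW : Wmap hT 4 4 = Wmap hT 1 1 := by
    rw [Wmap_apply, Wmap_apply, ← Equiv.sum_comp (Equiv.mulLeft₀ 4 h4), ← sub_eq_zero,
      ← Finset.sum_sub_distrib]
    have : ∀ i, T 4 (Equiv.mulLeft₀ 4 h4 i) 4 - T 1 i 1 =
        L (f i) (f 1) - L (f (1 + i)) (f 1) + L (f 1) (f (i + 1)) - L (f 1) (f i) := by
      intro i
      have := hL (f 1) (f i) (f 1)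
      rw [hga, hga, mul_one, ← hf, ← hf] at this
      exact this
    simp only [this, Finset.sum_add_distrib, Finset.sum_sub_distrib]
    have e1 : ∑ i, L (f (1 + i)) (f 1) = ∑ i, L (f i) (f 1) :=
      Equiv.sum_comp (Equiv.addLeft (1 : ZMod p)) (fun i => L (f i) (f 1))
    have e2 : ∑ i, L (f 1) (f (i + 1)) = ∑ i, L (f 1) (f i) :=
      Equiv.sum_comp (Equiv.addRight (1 : ZMod p)) (fun i => L (f 1) (f i))
    rw [e1, e2]; abel
  obtain ⟨H, hH⟩ := exists_H hT (W_zero hT (W_four hT hp hW))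
  let Hm : ((Multiplicative (ZMod p) × Multiplicative (ZMod p)) →₀ ℤ) →ₗ[ℤ] _ :=
    Finsupp.lift _ ℤ _ fun t => H t.1.toAdd t.2.toAdd
  have hcomp : (Submodule.mkQ (LinearMap.range (barD4 (PSL2 p)))).comp (barMap3 φ) =
      Hm.comp (barD3 (Multiplicative (ZMod p))) := by
    refine Finsupp.lhom_ext' fun t => LinearMap.ext_ring ?_
    obtain ⟨a, b, c⟩ := t
    have := hH a.toAdd b.toAdd c.toAdd
    have hs : ∀ u v, Hm (Finsupp.single (u, v) 1) = H u.toAdd v.toAdd := fun u v => by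
      simp only [Hm, Finsupp.lift_apply]
      rw [Finsupp.sum_single_index] <;> simp
    have h3 : barD3 (Multiplicative (ZMod p)) (Finsupp.single (a, b, c) 1) =
        Finsupp.single (b, c) 1 - Finsupp.single (a * b, c) 1 +
          Finsupp.single (a, b * c) 1 - Finsupp.single (a, b) 1 := by simp [barD3]
    show Submodule.Quotient.mk (barMap3 φ (Finsupp.single (a, b, c) 1)) =
      Hm (barD3 (Multiplicative (ZMod p)) (Finsupp.single (a, b, c) 1))
    rw [h3, map_sub, map_add, map_sub, hs, hs, hs, hs]
    simpa [barMap3, T, barT, f] using this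
  have := LinearMap.congr_fun hcomp x
  simp only [LinearMap.comp_apply, hx, map_zero] at this
  rw [Submodule.mkQ_apply, Submodule.Quotient.mk_eq_zero] at this
  obtain ⟨w, hw⟩ := this
  exact ⟨w, hw.symm⟩
end
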